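/- arXiv:2310.03709 — 2 statements merged into one kernel-verified Lean document; each statement's English description precedes it below -/
import Mathlib

section
/- Let K be a quadratic number field, E an elliptic curve over K given by y² = x³ + Ax + B, d ∈ K a nonsquare, and L = K(√d). If E(L) contains a subgroup isomorphic to C_{2p^k} for an odd prime p and an integer k > 0 (equivalently, a point of order 2p^k), then E(K) or E^d(K) contains a subgroup isomorphic to C_{2p^k}. -/
open WeierstrassCurve WeierstrassCurve.Affine

/-- The `n`-torsion subgroup `G[n]` of an additive commutative group `G`. -/
def nTorsion (G : Type*) [AddCommGroup G] (n : ℕ) : AddSubgroup G where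
  carrier := {x | n • x = 0}
  zero_mem' := by simp
  add_mem' := by
    intro a b ha hb
    simp only [Set.mem_setOf_eq, smul_add] at *
    rw [ha, hb, add_zero]
  neg_mem' := by
    intro a ha
    simp only [Set.mem_setOf_eq, smul_neg] at *
    rw [ha, neg_zero]

/-- The `p`-primary torsion subgroup `G[p^∞]` of an additive commutative group `G`. -/
def pPrimary (G : Type*) [AddCommGroup G] (p : ℕ) : AddSubgroup G where
  carrier := {x | ∃ k : ℕ, p ^ k • x = 0}
  zero_mem' := ⟨0, by simp⟩
  add_mem' := by
    rintro a b ⟨m, hm⟩ ⟨n, hn⟩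
    refine ⟨m + n, ?_⟩
    have h1 : (p ^ (m + n)) • a = 0 := by rw [pow_add, mul_comm, mul_smul, hm, smul_zero]
    have h2 : (p ^ (m + n)) • b = 0 := by rw [pow_add, mul_smul, hn, smul_zero]
    rw [smul_add, h1, h2, add_zero]
  neg_mem' := by
    rintro a ⟨m, hm⟩
    exact ⟨m, by rw [smul_neg, hm, neg_zero]⟩

/-- The Weierstrass curve over `K` with short Weierstrass equation `y² = x³ + Ax + B`. -/
def shortW {K : Type*} [CommRing K] (A B : K) : WeierstrassCurve K :=
  ⟨0, 0, 0, A, B⟩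


/-- A curve with `a₁ = a₂ = a₃ = 0`, with coefficients scaled by `u`: nonsingular points scale. -/
lemma scale_nonsingular {F : Type*} [Field F] {W V : WeierstrassCurve F} (u : F) (hu : u ≠ 0)
    (h1 : W.a₁ = 0) (h2 : W.a₂ = 0) (h3 : W.a₃ = 0) (k1 : V.a₁ = 0) (k2 : V.a₂ = 0) (k3 : V.a₃ = 0)
    (k4 : V.a₄ = u ^ 4 * W.a₄) (k6 : V.a₆ = u ^ 6 * W.a₆) {x y : F} (h : W.toAffine.Nonsingular x y) :
    V.toAffine.Nonsingular (u ^ 2 * x) (u ^ 3 * y) := by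
  rw [nonsingular_iff, equation_iff] at h ⊢
  simp only [h1, h2, h3, k1, k2, k3, k4, k6] at h ⊢
  obtain ⟨he, h⟩ := h
  refine ⟨by linear_combination u ^ 6 * he, ?_⟩
  rcases h with h | h
  · left
    intro h'
    apply h
    have h4 : u ^ 4 ≠ 0 := pow_ne_zero _ hu
    apply mul_left_cancel₀ h4
    linear_combination h'
  · right
    intro h'
    apply h
    have h4 : u ^ 3 ≠ 0 := pow_ne_zero _ hu
    apply mul_left_cancel₀ h4
    linear_combination h'

lemma scale_slope {F : Type*} [Field F] [DecidableEq F] {W V : WeierstrassCurve F} (u : F)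
    (hu : u ≠ 0)
    (h1 : W.a₁ = 0) (h2 : W.a₂ = 0) (h3 : W.a₃ = 0) (k1 : V.a₁ = 0) (k2 : V.a₂ = 0) (k3 : V.a₃ = 0)
    (k4 : V.a₄ = u ^ 4 * W.a₄) (x₁ x₂ y₁ y₂ : F) :
    V.toAffine.slope (u ^ 2 * x₁) (u ^ 2 * x₂) (u ^ 3 * y₁) (u ^ 3 * y₂) =
      u * W.toAffine.slope x₁ x₂ y₁ y₂ := by
  have hu2 : u ^ 2 ≠ 0 := pow_ne_zero _ hu
  have hu3 : u ^ 3 ≠ 0 := pow_ne_zero _ hu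
  have e : u ^ 3 * y₁ = -(u ^ 3 * y₂) ↔ y₁ = - y₂ := by
    rw [← mul_neg]; exact mul_right_inj' hu3
  simp only [Affine.slope, negY, h1, h2, h3, k1, k2, k3, k4, mul_right_inj' hu2, zero_mul, mul_zero,
    sub_zero, add_zero, e]
  split_ifs with hx hy
  · simp
  · have h' : u ^ 3 * y₁ - -(u ^ 3 * y₁) = u ^ 3 * (y₁ - -y₁) := by ring
    rw [h']
    by_cases hD : y₁ - -y₁ = 0
    · simp [hD]
    rw [mul_div_assoc', div_eq_div_iff (mul_ne_zero hu3 hD) hD]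
    ring
  · have : x₁ - x₂ ≠ 0 := sub_ne_zero.mpr hx
    rw [← mul_sub, ← mul_sub, mul_div_assoc', div_eq_div_iff (mul_ne_zero hu2 this) this]
    ring

/-- The isomorphism `(x, y) ↦ (u² x, u³ y)` as a group homomorphism. -/
noncomputable def scaleHom {F : Type*} [Field F] [DecidableEq F] {W V : WeierstrassCurve F} (u : F)
    (hu : u ≠ 0)
    (h1 : W.a₁ = 0) (h2 : W.a₂ = 0) (h3 : W.a₃ = 0) (k1 : V.a₁ = 0) (k2 : V.a₂ = 0) (k3 : V.a₃ = 0)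
    (k4 : V.a₄ = u ^ 4 * W.a₄) (k6 : V.a₆ = u ^ 6 * W.a₆) :
    W.toAffine.Point →+ V.toAffine.Point where
  toFun P := match P with
    | 0 => 0
    | .some _ _ h => .some _ _ (scale_nonsingular u hu h1 h2 h3 k1 k2 k3 k4 k6 h)
  map_zero' := rfl
  map_add' := by
    have hn : ∀ x y, V.toAffine.negY (u ^ 2 * x) (u ^ 3 * y) = u ^ 3 * W.toAffine.negY x y := by
      intro x y
      simp only [negY, h1, h3, k1, k3]
      ring
    have hu2 : u ^ 2 ≠ 0 := pow_ne_zero _ hu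
    have hu3 : u ^ 3 ≠ 0 := pow_ne_zero _ hu
    rintro (_ | ⟨x₁, y₁, g₁⟩) (_ | ⟨x₂, y₂, g₂⟩)
    any_goals rfl
    by_cases hxy : x₁ = x₂ ∧ y₁ = W.toAffine.negY x₂ y₂
    · rw [Point.add_of_Y_eq hxy.left hxy.right,
        Point.add_of_Y_eq (congr_arg _ hxy.left) (by rw [hxy.right, hn])]
    · have hxy' : ¬ (u ^ 2 * x₁ = u ^ 2 * x₂ ∧
          u ^ 3 * y₁ = V.toAffine.negY (u ^ 2 * x₂) (u ^ 3 * y₂)) := by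
        rw [hn, mul_right_inj' hu2, mul_right_inj' hu3]
        exact hxy
      rw [Point.add_some hxy, Point.add_some hxy']
      simp only [Point.some.injEq, scale_slope u hu h1 h2 h3 k1 k2 k3 k4]
      constructor
      · simp only [addX, h1, h2, k1, k2]
        ring
      · simp only [addY, negAddY, addX, negY, h1, h2, h3, k1, k2, k3]
        ring

lemma scaleHom_injective {F : Type*} [Field F] [DecidableEq F] {W V : WeierstrassCurve F} (u : F)
    (hu : u ≠ 0)
    (h1 : W.a₁ = 0) (h2 : W.a₂ = 0) (h3 : W.a₃ = 0) (k1 : V.a₁ = 0) (k2 : V.a₂ = 0) (k3 : V.a₃ = 0)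
    (k4 : V.a₄ = u ^ 4 * W.a₄) (k6 : V.a₆ = u ^ 6 * W.a₆) :
    Function.Injective (scaleHom u hu h1 h2 h3 k1 k2 k3 k4 k6) := by
  rintro (_ | _) (_ | _) h
  any_goals contradiction
  · rfl
  · have h' := Point.some.inj h
    simpa only [Point.some.injEq] using
      ⟨mul_left_cancel₀ (pow_ne_zero 2 hu) h'.1, mul_left_cancel₀ (pow_ne_zero 3 hu) h'.2⟩

/-- Galois descent of points. -/
lemma descend {K L : Type*} [Field K] [Field L] [DecidableEq K] [DecidableEq L] [Algebra K L]
    (σ : L →ₐ[K] L) (hfix : ∀ x, σ x = x → ∃ a, algebraMap K L a = x) (W : WeierstrassCurve K)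
    (P : (W.baseChange L).toAffine.Point) (hP : Point.map (W' := W) σ P = P) :
    ∃ Q : (W.baseChange K).toAffine.Point, Point.map (W' := W) (Algebra.ofId K L) Q = P := by
  rcases P with _ | ⟨x, y, h⟩
  · exact ⟨0, rfl⟩
  · have h' := Point.some.inj hP
    obtain ⟨a, rfl⟩ := hfix x h'.1
    obtain ⟨b, rfl⟩ := hfix y h'.2
    exact ⟨.some a b ((Affine.baseChange_nonsingular (W := W) (f := Algebra.ofId K L)
      (Algebra.ofId K L).injective a b).mp h), rfl⟩

/-- The group theory. -/
lemma group_part {G : Type*} [AddCommGroup G] (σ : G →+ G) (hσ : ∀ x, σ (σ x) = x)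
    (p k : ℕ) (hp : p.Prime) (hodd : Odd p) (hk : 0 < k) (g : G)
    (hg : addOrderOf g = 2 * p ^ k) :
    ∃ h : G, addOrderOf h = 2 * p ^ k ∧ (σ h = h ∨ σ h = -h) := by
  have hpk : 0 < p ^ k := pow_pos hp.pos k
  obtain ⟨m, rfl⟩ : ∃ m, k = m + 1 := ⟨k - 1, by omega⟩
  -- the point of order two
  have hT : ∃ T : G, addOrderOf T = 2 ∧ σ T = T := by
    have h0 : addOrderOf (p ^ (m + 1) • g) = 2 := by
      rw [addOrderOf_nsmul_of_dvd hpk.ne' (by rw [hg]; exact Dvd.intro_left _ rfl), hg]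
      exact Nat.mul_div_cancel _ hpk
    generalize p ^ (m + 1) • g = T at h0
    by_cases hf : σ T = T
    · exact ⟨T, h0, hf⟩
    · refine ⟨T + σ T, ?_, by rw [map_add, hσ, add_comm]⟩
      have hT2 : 2 • T = 0 := by rw [← h0]; exact addOrderOf_nsmul_eq_zero T
      apply addOrderOf_eq_prime
      · rw [smul_add, ← map_nsmul, hT2, map_zero, add_zero]
      · intro h
        apply hf
        rw [two_nsmul] at hT2
        rw [eq_neg_of_add_eq_zero_right h, neg_eq_of_add_eq_zero_right hT2]
  obtain ⟨T, hT2, hTσ⟩ := hT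
  have hQ : ∃ Q : G, addOrderOf Q = p ^ (m + 1) ∧ (σ Q = Q ∨ σ Q = -Q) := by
    have h0 : addOrderOf (2 • g) = p ^ (m + 1) := by
      rw [addOrderOf_nsmul_of_dvd two_ne_zero (by rw [hg]; exact Dvd.intro _ rfl), hg]
      exact Nat.mul_div_cancel_left _ two_pos
    generalize 2 • g = P at h0
    have hP : p ^ (m + 1) • P = 0 := by rw [← h0]; exact addOrderOf_nsmul_eq_zero P
    have hσP : p ^ (m + 1) • σ P = 0 := by rw [← map_nsmul, hP, map_zero]
    have := Fact.mk hp
    by_cases h1 : p ^ m • (P + σ P) = 0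
    · by_cases h2 : p ^ m • (P - σ P) = 0
      · exfalso
        have h3 : (p ^ m * 2) • P = 0 := by
          have : (p ^ m * 2) • P = p ^ m • (P + σ P) + p ^ m • (P - σ P) := by
            rw [mul_smul, ← smul_add]; congr 1; abel
          rw [this, h1, h2, add_zero]
        have h4 := addOrderOf_dvd_of_nsmul_eq_zero h3
        rw [h0] at h4
        rw [pow_succ] at h4
        have h5 := Nat.dvd_of_mul_dvd_mul_left (pow_pos hp.pos m) h4
        have h6 := (Nat.prime_dvd_prime_iff_eq hp Nat.prime_two).mp h5
        subst h6
        exact absurd hodd (by decide)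
      · refine ⟨P - σ P, addOrderOf_eq_prime_pow h2 ?_, Or.inr ?_⟩
        · rw [smul_sub, hP, hσP, sub_zero]
        · rw [map_sub, hσ, neg_sub]
    · refine ⟨P + σ P, addOrderOf_eq_prime_pow h1 ?_, Or.inl ?_⟩
      · rw [smul_add, hP, hσP, add_zero]
      · rw [map_add, hσ, add_comm]
  obtain ⟨Q, hQo, hQσ⟩ := hQ
  refine ⟨T + Q, ?_, ?_⟩
  · rw [(AddCommute.all T Q).addOrderOf_add_eq_mul_addOrderOf_of_coprime, hT2, hQo]
    rw [hT2, hQo]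
    exact Nat.Coprime.pow_right _ (Nat.coprime_two_left.mpr hodd)
  · rcases hQσ with h | h
    · left; rw [map_add, hTσ, h]
    · right
      have : -T = T := by
        have hT2 : 2 • T = 0 := by rw [← hT2]; exact addOrderOf_nsmul_eq_zero T
        rw [two_nsmul] at hT2
        exact neg_eq_of_add_eq_zero_right hT2
      rw [map_add, hTσ, h, neg_add, this]

lemma subgroup_of_order {G : Type*} [AddCommGroup G] (n : ℕ) (g : G) (hg : addOrderOf g = n) :
    ∃ H : AddSubgroup G, Nonempty (H ≃+ ZMod n) := by
  refine ⟨AddSubgroup.zmultiples g, ⟨?_⟩⟩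
  have h : Nat.card (AddSubgroup.zmultiples g) = n := by rw [Nat.card_zmultiples, hg]
  exact (h ▸ (zmodAddCyclicAddEquiv (G := AddSubgroup.zmultiples g) inferInstance)).symm

lemma order_of_subgroup {G : Type*} [AddCommGroup G] (n : ℕ)
    (h : ∃ H : AddSubgroup G, Nonempty (H ≃+ ZMod n)) : ∃ g : G, addOrderOf g = n := by
  obtain ⟨H, ⟨e⟩⟩ := h
  refine ⟨(e.symm 1 : H), ?_⟩
  rw [AddSubgroup.addOrderOf_coe, e.symm.addOrderOf_eq, ZMod.addOrderOf_one]

/-- The nontrivial automorphism of a quadratic extension. -/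
lemma exists_conj {K L : Type*} [Field K] [CharZero K] [Field L] [Algebra K L] (d : K)
    (hd : ¬ ∃ c : K, c ^ 2 = d) (hL : Module.finrank K L = 2) (s : L)
    (hs : s ^ 2 = algebraMap K L d) :
    ∃ σ : L →ₐ[K] L, σ s = -s ∧ (∀ x, σ (σ x) = x) ∧
      ∀ x, σ x = x → ∃ a, algebraMap K L a = x := by
  have : FiniteDimensional K L := Module.finite_of_finrank_pos (by omega)
  have : Algebra.IsQuadraticExtension K L := ⟨hL⟩
  have hsK : ∀ a, algebraMap K L a ≠ s := by
    intro a ha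
    apply hd
    refine ⟨a, (algebraMap K L).injective ?_⟩
    rw [map_pow, ha, hs]
  obtain ⟨σ, hσ⟩ : ∃ σ : L ≃ₐ[K] L, σ s ≠ s := by
    by_contra! h
    obtain ⟨a, ha⟩ := (IsGalois.mem_range_algebraMap_iff_fixed s).mpr h
    exact hsK a ha
  have hσs : σ s = -s := by
    have : (σ s) ^ 2 = s ^ 2 := by rw [← map_pow, hs, AlgEquiv.commutes]
    exact (sq_eq_sq_iff_eq_or_eq_neg.mp this).resolve_left hσ
  have hs0 : s ≠ 0 := by
    rintro rfl
    exact hsK 0 (map_zero _)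
  have hli : LinearIndependent K ![(1 : L), s] := by
    rw [LinearIndependent.pair_iff' one_ne_zero]
    intro a ha
    exact hsK a (by rw [← ha, Algebra.smul_def, mul_one])
  have hspan : ∀ x : L, ∃ a b : K, x = algebraMap K L a + algebraMap K L b * s := by
    intro x
    have ht := hli.span_eq_top_of_card_eq_finrank (by simp [hL])
    have hx : x ∈ Submodule.span K (Set.range ![(1 : L), s]) := by rw [ht]; trivial
    rw [Matrix.range_cons_cons_empty, Submodule.mem_span_pair] at hx
    obtain ⟨a, b, rfl⟩ := hx
    exact ⟨a, b, by simp [Algebra.smul_def]⟩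
  have : CharZero L := charZero_of_injective_algebraMap (algebraMap K L).injective
  refine ⟨σ, hσs, ?_, ?_⟩
  · intro x
    obtain ⟨a, b, rfl⟩ := hspan x
    simp [hσs]
  · intro x hx
    obtain ⟨a, b, rfl⟩ := hspan x
    refine ⟨a, ?_⟩
    simp only [AlgEquiv.coe_toAlgHom, map_add, map_mul, AlgEquiv.commutes, hσs] at hx
    have : 2 * (algebraMap K L b * s) = 0 := by linear_combination -hx
    have := (mul_eq_zero.mp this).resolve_left two_ne_zero
    rw [this, add_zero]

open Classical in
/-- Let `K` be a quadratic number field, `E : y² = x³ + Ax + B` an elliptic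
curve over `K`, `d ∈ K` a nonsquare and `L = K(√d)`. If `E(L)` contains a subgroup isomorphic
to `C_{2p^k}` for an odd prime `p` and `k > 0`, then `E(K)` or `E^d(K)` contains a subgroup
isomorphic to `C_{2p^k}`. -/
theorem stmt1 {K : Type*} [Field K] [NumberField K] (hK : Module.finrank ℚ K = 2)
    (A B d : K) (hd : ¬ ∃ c : K, c ^ 2 = d) (hΔ : (shortW A B).Δ ≠ 0)
    {L : Type*} [Field L] [Algebra K L] (hL : Module.finrank K L = 2)
    (s : L) (hs : s ^ 2 = algebraMap K L d)
    (p : ℕ) (hp : p.Prime) (hodd : Odd p) (k : ℕ) (hk : 0 < k)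
    (hsub : ∃ H : AddSubgroup (Affine.Point ((shortW A B).baseChange L)), Nonempty (H ≃+ ZMod (2 * p ^ k))) :
    (∃ H : AddSubgroup (Affine.Point ((shortW A B).baseChange K)), Nonempty (H ≃+ ZMod (2 * p ^ k))) ∨
      (∃ H : AddSubgroup (Affine.Point ((shortW (d ^ 2 * A) (d ^ 3 * B)).baseChange K)),
        Nonempty (H ≃+ ZMod (2 * p ^ k))) := by
  obtain ⟨σ, hσs, hσσ, hfix⟩ := exists_conj d hd hL s hs
  have hs0 : s ≠ 0 := by
    rintro rfl
    apply hd
    refine ⟨0, (algebraMap K L).injective ?_⟩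
    rw [← hs]; simp
  obtain ⟨g, hg⟩ := order_of_subgroup _ hsub
  obtain ⟨P, hP, hPσ⟩ := group_part (Point.map (W' := shortW A B) σ)
    (by
      rintro (_ | ⟨x, y, h⟩)
      · rfl
      · rw [Point.map_some, Point.map_some]
        simp only [hσσ]) p k hp hodd hk g hg
  rcases hPσ with h | h
  · left
    obtain ⟨Q, hQ⟩ := descend σ hfix _ P h
    refine subgroup_of_order _ Q ?_
    rw [← hP, ← hQ]
    exact (addOrderOf_injective _ (Point.map_injective (W' := shortW A B) (Algebra.ofId K L)) Q).symm
  · right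
    let φ : ((shortW A B).baseChange L).toAffine.Point →+
        ((shortW (d ^ 2 * A) (d ^ 3 * B)).baseChange L).toAffine.Point :=
      scaleHom s hs0 (map_zero _) (map_zero _) (map_zero _) (map_zero _) (map_zero _) (map_zero _)
        (by
          change algebraMap K L (d ^ 2 * A) = s ^ 4 * algebraMap K L A
          rw [map_mul, map_pow, ← hs]; ring)
        (by
          change algebraMap K L (d ^ 3 * B) = s ^ 6 * algebraMap K L B
          rw [map_mul, map_pow, ← hs]; ring)
    have hφ : Function.Injective φ := scaleHom_injective ..
    have hφP : Point.map (W' := shortW (d ^ 2 * A) (d ^ 3 * B)) σ (φ P) = φ P := by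
      rcases P with _ | ⟨x, y, hxy⟩
      · rfl
      · have h' := Point.some.inj h
        have hx : σ x = x := h'.1
        have hy : σ y = -y := by
          have : σ y = ((shortW A B).baseChange L).toAffine.negY x y := h'.2
          rw [this]
          simp [negY, shortW, WeierstrassCurve.map]
        change Point.some _ _ _ = Point.some _ _ _
        simp only [Point.some.injEq]
        constructor
        · simp [hx, hσs]
        · simp only [AlgHom.toRingHom_eq_coe, map_mul, map_pow, hσs, hy]
          ring
    obtain ⟨Q, hQ⟩ := descend σ hfix _ (φ P) hφP
    refine subgroup_of_order _ Q ?_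
    rw [← hP, ← addOrderOf_injective φ hφ P, ← hQ]
    exact (addOrderOf_injective _ (Point.map_injective
      (W' := shortW (d ^ 2 * A) (d ^ 3 * B)) (Algebra.ofId K L)) Q).symm
end

section
/- Let K be a quadratic number field, E an elliptic curve over K, and L a quadratic extension of K. If E(K)_tor is isomorphic to C_4, then E(L)_tor is not isomorphic to C_4 ⊕ C_8. -/
open WeierstrassCurve WeierstrassCurve.Affine

/-- The additive endomorphism candidate of `C₄ ⊕ C₈` with given images of the generators. -/
def linC (u v : ZMod 4 × ZMod 8) (x : ZMod 4 × ZMod 8) : ZMod 4 × ZMod 8 :=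
  x.1.val • u + x.2.val • v

set_option maxRecDepth 100000 in
lemma finite_check : ∀ u v : ZMod 4 × ZMod 8, ¬ (4 • u = 0 ∧ linC u v u = (1, 0) ∧
    linC u v v = (0, 1) ∧
    (Finset.univ.filter fun x => linC u v x = x).card = 4 ∧
    (Finset.univ.filter fun x => linC u v x = x ∧ 2 • x = 0).card = 2) := by
  change ∀ u v : Fin 4 × Fin 8, _
  decide +kernel

lemma group_lemma (s : (ZMod 4 × ZMod 8) →+ (ZMod 4 × ZMod 8)) (hs : ∀ x, s (s x) = x)
    (j : ZMod 4 →+ (ZMod 4 × ZMod 8)) (hj : Function.Injective j)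
    (hr : ∀ x, s x = x ↔ ∃ n, j n = x) : False := by
  have key : ∀ x, s x = linC (s (1, 0)) (s (0, 1)) x := by
    intro x
    have hx : x = x.1.val • ((1, 0) : ZMod 4 × ZMod 8) + x.2.val • ((0, 1) : ZMod 4 × ZMod 8) := by
      ext <;> simp
    conv_lhs => rw [hx]
    rw [map_add, map_nsmul, map_nsmul, linC]
  refine finite_check (s (1, 0)) (s (0, 1)) ⟨?_, ?_, ?_, ?_, ?_⟩
  · rw [← map_nsmul, show 4 • ((1, 0) : ZMod 4 × ZMod 8) = 0 by decide, map_zero]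
  · rw [← key, hs]
  · rw [← key, hs]
  · have : (Finset.univ.filter fun x => linC (s (1, 0)) (s (0, 1)) x = x)
        = Finset.univ.image j := by
      ext x
      simp only [← key, Finset.mem_filter, Finset.mem_univ, true_and, Finset.mem_image, hr]
    rw [this, Finset.card_image_of_injective _ hj]
    rfl
  · have : (Finset.univ.filter fun x => linC (s (1, 0)) (s (0, 1)) x = x ∧ 2 • x = 0)
        = (Finset.univ.filter fun n : ZMod 4 => 2 • n = 0).image j := by
      ext x
      simp only [← key, Finset.mem_filter, Finset.mem_univ, true_and, Finset.mem_image, hr]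
      constructor
      · rintro ⟨⟨n, rfl⟩, h⟩
        refine ⟨n, hj ?_, rfl⟩
        rw [map_nsmul, h, map_zero]
      · rintro ⟨n, hn, rfl⟩
        exact ⟨⟨n, rfl⟩, by rw [← map_nsmul, hn, map_zero]⟩
    rw [this, Finset.card_image_of_injective _ hj]
    decide

/-- Abstract version: an involution of `B` whose fixed points are the image of `A`. -/
lemma abstract_lemma {A B : Type*} [AddCommGroup A] [AddCommGroup B] (s : B →+ B)
    (hs : ∀ x, s (s x) = x) (j : A →+ B) (hj : Function.Injective j)
    (hr : ∀ x, s x = x ↔ ∃ n, j n = x)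
    (e : AddCommGroup.torsion A ≃+ ZMod 4)
    (f : AddCommGroup.torsion B ≃+ (ZMod 4 × ZMod 8)) : False := by
  have hst : ∀ x ∈ AddCommGroup.torsion B, s x ∈ AddCommGroup.torsion B :=
    fun x hx => AddMonoidHom.isOfFinAddOrder s hx
  have hjt : ∀ x ∈ AddCommGroup.torsion A, j x ∈ AddCommGroup.torsion B :=
    fun x hx => AddMonoidHom.isOfFinAddOrder j hx
  let s' : AddCommGroup.torsion B →+ AddCommGroup.torsion B :=
    (s.comp (AddCommGroup.torsion B).subtype).codRestrict _ (fun x => hst x x.2)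
  let j' : AddCommGroup.torsion A →+ AddCommGroup.torsion B :=
    (j.comp (AddCommGroup.torsion A).subtype).codRestrict _ (fun x => hjt x x.2)
  have hs' : ∀ x, s' (s' x) = x := fun x => Subtype.ext (hs x)
  have hj' : Function.Injective j' := fun x y h => Subtype.ext (hj (congrArg Subtype.val h))
  have hr' : ∀ x, s' x = x ↔ ∃ n, j' n = x := by
    intro x
    constructor
    · intro h
      obtain ⟨n, hn⟩ := (hr x).1 (congrArg Subtype.val h)
      refine ⟨⟨n, ?_⟩, Subtype.ext hn⟩
      have : IsOfFinAddOrder (j n) := hn ▸ x.2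
      exact (hj.isOfFinAddOrder_iff).1 this
    · rintro ⟨n, rfl⟩
      exact Subtype.ext ((hr _).2 ⟨n, rfl⟩)
  refine group_lemma ((f.toAddMonoidHom.comp s').comp f.symm.toAddMonoidHom) ?_
    ((f.toAddMonoidHom.comp j').comp e.symm.toAddMonoidHom) ?_ ?_
  · intro x
    simp [hs']
  · intro x y h
    simpa [hj'.eq_iff] using h
  · intro x
    have := hr' (f.symm x)
    simp only [AddMonoidHom.comp_apply, AddEquiv.coe_toAddMonoidHom, AddMonoidHom.coe_coe,
      ← AddEquiv.eq_symm_apply]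
    rw [this]
    exact ⟨fun ⟨n, hn⟩ => ⟨e n, by simpa using hn⟩, fun ⟨n, hn⟩ => ⟨_, hn⟩⟩

lemma exists_invol {K L : Type*} [Field K] [CharZero K] [Field L] [Algebra K L]
    (hL : Module.finrank K L = 2) :
    ∃ σ : L →ₐ[K] L, (∀ x, σ (σ x) = x) ∧ ∀ x, σ x = x → ∃ y, algebraMap K L y = x := by
  have : Algebra.IsQuadraticExtension K L := { finrank_eq_two' := hL }
  have : FiniteDimensional K L := Module.finite_of_finrank_pos (by omega)
  have : IsGalois K L := inferInstance
  have hc : Nat.card (L ≃ₐ[K] L) = 2 := by rw [IsGalois.card_aut_eq_finrank, hL]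
  obtain ⟨g, hg⟩ := IsCyclic.exists_generator (α := L ≃ₐ[K] L)
  have hg2 : g * g = 1 := by
    have := pow_card_eq_one' (x := g)
    rwa [hc, pow_two] at this
  refine ⟨g.toAlgHom, fun x => congrArg (fun t : L ≃ₐ[K] L => t x) hg2, fun x hx => ?_⟩
  refine (IsGalois.mem_range_algebraMap_iff_fixed x).2 fun t => ?_
  have : g ∈ MulAction.stabilizer (L ≃ₐ[K] L) x := hx
  exact (Subgroup.zpowers_le.2 this) (hg t)

open scoped Classical in
/-- Let `K` be a quadratic number field, `E` an elliptic curve over `K`, and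
`L` a quadratic extension of `K`. If `E(K)_tor ≃ C₄`, then `E(L)_tor ≄ C₄ ⊕ C₈`. -/
theorem stmt2 {K : Type*} [Field K] [NumberField K] (hK : Module.finrank ℚ K = 2)
    {L : Type*} [Field L] [Algebra K L] (hL : Module.finrank K L = 2)
    (W : WeierstrassCurve K) (hW : W.Δ ≠ 0)
    (h4 : Nonempty (AddCommGroup.torsion (Affine.Point (W.baseChange K)) ≃+ ZMod 4)) :
    IsEmpty (AddCommGroup.torsion (Affine.Point (W.baseChange L)) ≃+ (ZMod 4 × ZMod 8)) := by
  obtain ⟨e⟩ := h4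
  refine ⟨fun f => ?_⟩
  obtain ⟨σ, h2, hfix⟩ := exists_invol hL
  refine abstract_lemma (Point.map (W' := W) σ) ?_ (Point.map (W' := W) (Algebra.ofId K L))
    (Point.map_injective _) ?_ e f
  · rintro (_ | ⟨x, y, h⟩)
    · rfl
    · simp only [Point.map_some, h2]
  · rintro (_ | ⟨x, y, h⟩)
    · exact ⟨fun _ => ⟨0, rfl⟩, fun _ => rfl⟩
    · constructor
      · intro hP
        rw [Point.map_some, Point.some.injEq] at hP
        obtain ⟨x, rfl⟩ := hfix _ hP.1
        obtain ⟨y, rfl⟩ := hfix _ hP.2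
        exact ⟨.some x y ((Affine.baseChange_nonsingular W (f := Algebra.ofId K L) (Algebra.ofId K L).injective x y).1 h), rfl⟩
      · rintro ⟨n, hn⟩
        rw [← hn, Point.map_map]
        congr 1
        congr 1
        exact Subsingleton.elim _ _
end
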